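/- Let n, s be positive integers with n ≥ 2s, and let a ∈ {n−s+1, …, n}. Then, as an identity of polynomials in q, ∑_{π ∈ C_{n,s,a}} q^{maj(π⁻¹)} = ∑_{w ∈ C_{n,s−1}} q^{maj(w⁻¹)} − ∑_{b=n−s+2}^{a} ∑_{w ∈ C_{n,s−1,b}} q^{maj(w⁻¹)}. -/

import Mathlib

open Polynomial

/-- `w` has an increasing subsequence of length `m`. -/
def HasIncSubseq {n : ℕ} (w : Equiv.Perm (Fin n)) (m : ℕ) : Prop :=
  ∃ f : Fin m → Fin n, StrictMono f ∧ StrictMono fun j => w (f j)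

/-- The length of the longest increasing subsequence of `w`. -/
noncomputable def isLen {n : ℕ} (w : Equiv.Perm (Fin n)) : ℕ :=
  sSup {m | HasIncSubseq w m}

/-- The first `n - s` values of `w` are increasing (positions `0,…,n-s-1` in 0-indexing,
i.e. `w(1) < ⋯ < w(n-s)` in 1-indexing). -/
def PrefixInc (n s : ℕ) (w : Equiv.Perm (Fin n)) : Prop :=
  ∀ i j : Fin n, (i : ℕ) < j → (j : ℕ) < n - s → w i < w j

/-- Major index of a permutation: the sum of the (1-indexed) descent positions.
Position `i ∈ {0,…,n-2}` (0-indexed) contributes `i + 1`. -/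
def maj {n : ℕ} (σ : Equiv.Perm (Fin n)) : ℕ :=
  ∑ i ∈ Finset.range n,
    if h : i + 1 < n then
      if σ ⟨i + 1, h⟩ < σ ⟨i, Nat.lt_of_succ_lt h⟩ then i + 1 else 0
    else 0

/-- The q-integer `[m]_q = 1 + q + ⋯ + q^{m-1}` as a polynomial in `q = X` over `ℤ`. -/
noncomputable def qInt (m : ℕ) : Polynomial ℤ :=
  ∑ i ∈ Finset.range m, (X : Polynomial ℤ) ^ i

/-- The set `Π_{n,k}` of permutations whose first `n - k` values are increasing and whose
longest increasing subsequence has length exactly `n - k`, as a `Finset`. -/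
noncomputable def PiFinset (n k : ℕ) : Finset (Equiv.Perm (Fin n)) :=
  @Finset.filter _ (fun w => PrefixInc n k w ∧ isLen w = n - k) (Classical.decPred _)
    Finset.univ

/-- The set `C_{n,s}` of permutations whose first `n - s` values are increasing,
as a `Finset`. -/
noncomputable def CFinset (n s : ℕ) : Finset (Equiv.Perm (Fin n)) :=
  @Finset.filter _ (fun w => PrefixInc n s w) (Classical.decPred _) Finset.univ

/-- The prefix `w(1),…,w(a)` (1-indexed) contains an increasing subsequence of length `m`. -/
def HasIncSubseqPrefix {n : ℕ} (w : Equiv.Perm (Fin n)) (a m : ℕ) : Prop :=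
  ∃ f : Fin m → Fin n, StrictMono f ∧ (∀ j, (f j : ℕ) < a) ∧ StrictMono fun j => w (f j)

/-- Membership in `C_{n,s,a}`: `π ∈ C_{n,s}`, the prefix of length `a` contains an increasing
subsequence of length `n - s + 1`, but the prefix of length `a - 1` does not. -/
def MemCa (n s a : ℕ) (π : Equiv.Perm (Fin n)) : Prop :=
  PrefixInc n s π ∧ HasIncSubseqPrefix π a (n - s + 1) ∧
    ¬ HasIncSubseqPrefix π (a - 1) (n - s + 1)

/-- The set `C_{n,s,a}` as a `Finset`. -/
noncomputable def CaFinset (n s a : ℕ) : Finset (Equiv.Perm (Fin n)) :=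
  @Finset.filter _ (fun π => MemCa n s a π) (Classical.decPred _) Finset.univ

open Finset in
/-- `BumpStep A y z B`: inserting `y` into the increasing row `A` bumps `z`, the least entry
exceeding `y`, and leaves the row `B`. -/
structure BumpStep {α : Type*} [LinearOrder α] (A : Finset α) (y z : α) (B : Finset α) : Prop where
  mem : z ∈ A
  notMem : y ∉ A
  lt : y < z
  lt_of_lt : ∀ a ∈ A, a < z → a < y
  eq : B = insert y (A.erase z)

/-- `Bumps A ys zs B`: inserting the letters `ys` one after another into the row `A` bumps the
letters `zs` and leaves the row `B`. -/
inductive Bumps {α : Type*} [LinearOrder α] : Finset α → List α → List α → Finset α → Prop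
  | nil (A : Finset α) : Bumps A [] [] A
  | cons {A B C : Finset α} {y z : α} {ys zs : List α} :
      BumpStep A y z B → Bumps B ys zs C → Bumps A (y :: ys) (z :: zs) C

theorem List.pair_sublist_cons_iff {α : Type*} {u v z : α} {L : List α} :
    [v, u].Sublist (z :: L) ↔ [v, u].Sublist L ∨ v = z ∧ u ∈ L := by
  rw [List.sublist_cons_iff]
  simp only [List.cons.injEq]
  constructor
  · rintro (h | ⟨r, ⟨rfl, rfl⟩, h⟩)
    · exact Or.inl h
    · exact Or.inr ⟨rfl, List.singleton_sublist.1 h⟩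
  · rintro (h | ⟨rfl, h⟩)
    · exact Or.inl h
    · exact Or.inr ⟨[u], ⟨rfl, rfl⟩, List.singleton_sublist.2 h⟩

section Row

variable {α : Type*} [LinearOrder α] {A B C : Finset α} {y z : α} {ys zs : List α}

namespace BumpStep

theorem insert_eq (h : BumpStep A y z B) : insert y A = insert z B := by
  rw [h.eq, Finset.insert_comm, Finset.insert_erase h.mem]

theorem notMem_right (h : BumpStep A y z B) : z ∉ B := by
  have := h.lt.ne'
  rw [h.eq]; simp [this]

theorem mem_right (h : BumpStep A y z B) : y ∈ B := by
  rw [h.eq]; simp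

theorem le_of_lt (h : BumpStep A y z B) : ∀ b ∈ B, b < z → b ≤ y := by
  intro b hb hbz
  rw [h.eq, Finset.mem_insert] at hb
  rcases hb with rfl | hb
  · exact le_rfl
  · exact (h.lt_of_lt b (Finset.mem_of_mem_erase hb) hbz).le

theorem left_eq (h : BumpStep A y z B) : A = insert z (B.erase y) := by
  have := h.notMem
  rw [h.eq, Finset.erase_insert (by simp [this]), Finset.insert_erase h.mem]

theorem card_eq (h : BumpStep A y z B) : B.card = A.card := by
  have h1 := congrArg Finset.card h.insert_eq
  rw [Finset.card_insert_of_notMem h.notMem, Finset.card_insert_of_notMem h.notMem_right] at h1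
  omega

/-- A bump step is determined by its outcome. -/
theorem left_unique {A' : Finset α} {y' : α} (h : BumpStep A y z B) (h' : BumpStep A' y' z B) :
    A = A' ∧ y = y' := by
  have e : y = y' := le_antisymm (h'.le_of_lt y h.mem_right h.lt) (h.le_of_lt y' h'.mem_right h'.lt)
  subst e
  exact ⟨h.left_eq.trans h'.left_eq.symm, rfl⟩

/-- A bump step is determined by the row and the inserted letter. -/
theorem right_unique {z' : α} {B' : Finset α} (h : BumpStep A y z B) (h' : BumpStep A y z' B') :
    z = z' ∧ B = B' := by
  have e : z = z' := le_antisymm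
    (not_lt.1 fun hlt => (h.lt_of_lt z' h'.mem hlt).not_gt h'.lt)
    (not_lt.1 fun hlt => (h'.lt_of_lt z h.mem hlt).not_gt h.lt)
  subst e
  exact ⟨rfl, h.eq.trans h'.eq.symm⟩

/-- Bump steps exist for letters smaller than some row entry. -/
theorem exists_of_lt (hy : y ∉ A) (h : ∃ a ∈ A, y < a) : ∃ z B, BumpStep A y z B := by
  have hne : (A.filter (y < ·)).Nonempty := by
    obtain ⟨a, ha, hya⟩ := h
    exact ⟨a, by simp [ha, hya]⟩
  have hmin := Finset.min'_mem _ hne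
  rw [Finset.mem_filter] at hmin
  refine ⟨_, _, hmin.1, hy, hmin.2, fun a ha haz => ?_, rfl⟩
  by_contra hc
  have hlt : y < a := lt_of_le_of_ne (not_lt.1 hc) (by rintro rfl; exact hy ha)
  exact absurd haz (not_lt.2 (Finset.min'_le _ _ (by simp [ha, hlt])))

end BumpStep

namespace Bumps

theorem length_eq (h : Bumps A ys zs B) : ys.length = zs.length := by
  induction h with
  | nil => rfl
  | cons _ _ ih => simp [ih]

theorem card_eq (h : Bumps A ys zs B) : B.card = A.card := by
  induction h with
  | nil => rfl
  | cons h _ ih => rw [ih, h.card_eq]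

theorem mem_iff (h : Bumps A ys zs B) (x : α) : x ∈ A ∨ x ∈ ys ↔ x ∈ zs ∨ x ∈ B := by
  induction h with
  | nil => simp
  | cons h _ ih =>
    have := congrArg (x ∈ ·) h.insert_eq
    simp only [Finset.mem_insert, List.mem_cons, eq_iff_iff] at this ⊢
    tauto

/-- Row insertion is injective on bumping words. -/
theorem left_unique {A' : Finset α} {ys' : List α} (h : Bumps A ys zs B)
    (h' : Bumps A' ys' zs B) : A = A' ∧ ys = ys' := by
  induction h generalizing A' ys' with
  | nil => cases h'; exact ⟨rfl, rfl⟩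
  | cons h _ ih =>
    cases h' with
    | cons k' h' =>
      obtain ⟨rfl, rfl⟩ := ih h'
      obtain ⟨rfl, rfl⟩ := h.left_unique k'
      exact ⟨rfl, rfl⟩

theorem right_unique {B' : Finset α} {zs' : List α} (h : Bumps A ys zs B)
    (h' : Bumps A ys zs' B') : zs = zs' ∧ B = B' := by
  induction h generalizing zs' with
  | nil => cases h'; exact ⟨rfl, rfl⟩
  | cons h _ ih =>
    cases h' with
    | cons k' h' =>
      obtain ⟨rfl, rfl⟩ := h.right_unique k'
      obtain ⟨rfl, rfl⟩ := ih h'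
      exact ⟨rfl, rfl⟩

theorem append_singleton (h : Bumps A ys zs B) (h' : BumpStep B y z C) :
    Bumps A (ys ++ [y]) (zs ++ [z]) C := by
  induction h with
  | nil => exact .cons h' (.nil _)
  | cons k _ ih => exact .cons k (ih h')

/-- Deleting an entry of the final row that has enough smaller entries still leaves a row
reachable by bumping out the same letters. -/
theorem exists_erase (h : Bumps A ys zs B) {x : α} (hx : x ∈ B)
    (hc : zs.length ≤ (B.filter (· < x)).card) :
    ∃ x' ∈ A, ∃ ys', Bumps (A.erase x') ys' zs (B.erase x) ∧
      (B.filter (· < x)).card ≤ (A.filter (· < x')).card + zs.length := by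
  induction h with
  | nil => exact ⟨x, hx, [], .nil _, by simp⟩
  | @cons A B C y z ys zs h _ ih =>
    simp only [List.length_cons] at hc
    obtain ⟨x', hx', ys', hb, hcard⟩ := ih hx (by omega)
    have hz := h.notMem_right
    by_cases hxy : x' = y
    · subst hxy
      have hne : (B.filter (· < x')).Nonempty := by
        rw [← Finset.card_pos]; omega
      obtain ⟨hbB, hbx⟩ := Finset.mem_filter.1 (Finset.max'_mem _ hne)
      have hmax := fun a (ha : a ∈ B.filter (· < x')) => Finset.le_max' _ a ha
      set b := (B.filter (· < x')).max' hne
      have hbz : b < z := hbx.trans h.lt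
      have hmemA : ∀ a, a ∈ A ↔ a = z ∨ (a ≠ x' ∧ a ∈ B) := by
        intro a; rw [h.left_eq]; simp
      refine ⟨b, (hmemA b).2 (Or.inr ⟨hbx.ne, hbB⟩), b :: ys', .cons ⟨?_, ?_, hbz, ?_, ?_⟩ hb, ?_⟩
      · simp [hbz.ne', h.mem]
      · simp
      · intro a ha haz
        obtain ⟨hab, haA⟩ := Finset.mem_erase.1 ha
        have hax := h.lt_of_lt a haA haz
        have haB := ((hmemA a).1 haA).resolve_left haz.ne
        exact lt_of_le_of_ne (hmax a (by simp [haB.2, hax])) hab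
      · ext a
        simp only [Finset.mem_insert, Finset.mem_erase, hmemA]
        constructor
        · rintro ⟨h1, h2⟩
          by_cases hab : a = b
          · exact Or.inl hab
          · exact Or.inr ⟨by rintro rfl; exact hz h2, hab, Or.inr ⟨h1, h2⟩⟩
        · rintro (rfl | ⟨h1, h2, h3⟩)
          · exact ⟨hbx.ne, hbB⟩
          · exact h3.resolve_left h1
      · have : B.filter (· < x') = insert b (A.filter (· < b)) := by
          ext a
          simp only [Finset.mem_filter, Finset.mem_insert, hmemA]
          constructor
          · rintro ⟨h1, h2⟩
            rcases (hmax a (by simp [h1, h2])).eq_or_lt with h3 | h3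
            · exact Or.inl h3
            · exact Or.inr ⟨Or.inr ⟨h2.ne, h1⟩, h3⟩
          · rintro (rfl | ⟨h1, h2⟩)
            · exact ⟨hbB, hbx⟩
            · exact ⟨(h1.resolve_left (h2.trans hbz).ne).2, h2.trans hbx⟩
        rw [this, Finset.card_insert_of_notMem (by simp)] at hcard
        simp only [List.length_cons]
        omega
    · have hxz : x' ≠ z := by rintro rfl; exact hz hx'
      have hxA : x' ∈ A := by rw [h.left_eq]; simp [hxy, hx']
      refine ⟨x', hxA, y :: ys', .cons ⟨?_, ?_, h.lt, ?_, ?_⟩ hb, ?_⟩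
      · simp [hxz.symm, h.mem]
      · simp [h.notMem]
      · intro a ha
        exact h.lt_of_lt a (Finset.mem_of_mem_erase ha)
      · rw [h.eq, Finset.erase_insert_of_ne (Ne.symm hxy), Finset.erase_right_comm]
      · have hcard' : (B.filter (· < x')).card ≤ (A.filter (· < x')).card + 1 := by
          have : B.filter (· < x') ⊆ insert y (A.filter (· < x')) := by
            intro a ha
            rw [h.eq] at ha
            simp only [Finset.mem_filter, Finset.mem_insert, Finset.mem_erase] at ha ⊢
            tauto
          exact (Finset.card_le_card this).trans (Finset.card_insert_le _ _)
        simp only [List.length_cons]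
        omega

/-- Adjoining an entry to the final row gives a row reachable by bumping out the same letters. -/
theorem exists_insert (h : Bumps A ys zs B) (hnd : zs.Nodup) (hzB : ∀ z ∈ zs, z ∉ B) {x : α}
    (hx : x ∉ B) (hxz : x ∉ zs) :
    ∃ x' ys', x' ∉ A ∧ Bumps (insert x' A) ys' zs (insert x B) := by
  induction h with
  | nil => exact ⟨x, [], hx, .nil _⟩
  | @cons A B C y z ys zs h _ ih =>
    rw [List.nodup_cons] at hnd
    rw [List.mem_cons, not_or] at hxz
    obtain ⟨x', ys', hx', hb⟩ :=
      ih hnd.2 (fun a ha => hzB a (List.mem_cons_of_mem _ ha)) hx hxz.2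
    have hx'z : x' ≠ z := by
      rintro rfl
      have := (hb.mem_iff x').1 (Or.inl (Finset.mem_insert_self _ _))
      rw [Finset.mem_insert] at this
      rcases this with h1 | h1 | h1
      · exact hnd.1 h1
      · exact hxz.1 h1.symm
      · exact hzB x' (by simp) h1
    have hx'y : x' ≠ y := by rintro rfl; exact hx' h.mem_right
    have hx'A : x' ∉ A := by
      rw [h.left_eq]; simp [hx'z, hx']
    by_cases hc : y < x' ∧ x' < z
    · refine ⟨y, x' :: ys', h.notMem, .cons ⟨?_, ?_, hc.2, ?_, ?_⟩ hb⟩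
      · simp [h.mem]
      · simp [hx'A, hx'y]
      · intro a ha haz
        rcases Finset.mem_insert.1 ha with rfl | ha
        · exact hc.1
        · exact (h.lt_of_lt a ha haz).trans hc.1
      · rw [h.eq, Finset.erase_insert_of_ne h.lt.ne]
    · refine ⟨x', y :: ys', hx'A, .cons ⟨?_, ?_, h.lt, ?_, ?_⟩ hb⟩
      · simp [h.mem]
      · simp [h.notMem, hx'y.symm]
      · intro a ha haz
        rcases Finset.mem_insert.1 ha with rfl | ha
        · exact lt_of_le_of_ne (not_lt.1 fun h' => hc ⟨h', haz⟩) hx'y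
        · exact h.lt_of_lt a ha haz
      · rw [h.eq, Finset.erase_insert_of_ne hx'z, Finset.insert_comm]

end Bumps

theorem List.pair_sublist_append_iff {u v : α} (huv : u < v) {R L : List α}
    (hR : R.Pairwise (· < ·)) :
    [v, u].Sublist (R ++ L) ↔ [v, u].Sublist L ∨ v ∈ R ∧ u ∈ L := by
  induction R with
  | nil => simp
  | cons r R ih =>
    rw [List.pairwise_cons] at hR
    rw [List.cons_append, List.pair_sublist_cons_iff, ih hR.2, List.mem_append, List.mem_cons]
    constructor
    · rintro ((h | h) | ⟨rfl, h | h⟩)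
      · exact Or.inl h
      · exact Or.inr ⟨Or.inr h.1, h.2⟩
      · exact absurd (hR.1 u h) huv.not_gt
      · exact Or.inr ⟨Or.inl rfl, h⟩
    · rintro (h | ⟨rfl | h, h'⟩)
      · exact Or.inl (Or.inl h)
      · exact Or.inr ⟨rfl, Or.inr h'⟩
      · exact Or.inl (Or.inr ⟨h, h'⟩)

theorem Finset.pair_sublist_sort_append_iff {u v : α} (huv : u < v) {L : List α} :
    [v, u].Sublist (A.sort ++ L) ↔ [v, u].Sublist L ∨ v ∈ A ∧ u ∈ L := by
  rw [List.pair_sublist_append_iff huv A.sortedLT_sort.pairwise, Finset.mem_sort]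

/-- Row insertion preserves the relative position of adjacent values. -/
theorem Bumps.pair_sublist_iff {u v : α} (huv : u ⋖ v) (h : Bumps A ys zs B) (rest : List α) :
    [v, u].Sublist (A.sort ++ (ys ++ rest)) ↔ [v, u].Sublist (zs ++ (B.sort ++ rest)) := by
  induction h with
  | nil => rfl
  | @cons A B C y z ys zs h hb ih =>
    have hmem : ∀ x, x ∈ zs ++ (C.sort ++ rest) ↔ x ∈ B ∨ x ∈ ys ++ rest := by
      intro x
      have := hb.mem_iff x
      simp only [List.mem_append, Finset.mem_sort]
      tauto
    have hins : v = y ∨ v ∈ A ↔ v = z ∨ v ∈ B := by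
      simpa using congrArg (v ∈ ·) h.insert_eq
    have hkey : v ∈ A ∧ u = y ↔ v = z ∧ u ∈ B := by
      constructor
      · rintro ⟨hv, rfl⟩
        refine ⟨?_, h.mem_right⟩
        rcases lt_trichotomy v z with hvz | hvz | hvz
        · exact absurd (h.lt_of_lt v hv hvz) huv.lt.not_gt
        · exact hvz
        · exact absurd hvz (huv.2 h.lt)
      · rintro ⟨rfl, hu⟩
        exact ⟨h.mem, ((h.le_of_lt u hu huv.lt).eq_or_lt).resolve_right fun h' => huv.2 h' h.lt⟩
    rw [List.cons_append (as := zs), List.pair_sublist_cons_iff, ← ih, hmem,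
      Finset.pair_sublist_sort_append_iff huv.lt, Finset.pair_sublist_sort_append_iff huv.lt,
      List.cons_append, List.pair_sublist_cons_iff, List.mem_cons]
    clear ih hmem
    generalize (v = y) = p, (v = z) = q, (u = y) = r at *
    grind

/-- `A` is the set of least end points of the increasing subsequences of `L`, by length. -/
structure IsRow (L : List α) (A : Finset α) : Prop where
  bound : ∀ l e, (l ++ [e]).Sublist L → (l ++ [e]).Pairwise (· < ·) →
    l.length + 1 ≤ (A.filter (· ≤ e)).card
  attained : ∀ a ∈ A, ∃ l : List α, (l ++ [a]).Sublist L ∧ (l ++ [a]).Pairwise (· < ·) ∧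
    l.length + 1 = (A.filter (· ≤ a)).card

namespace IsRow

variable {L : List α}

theorem nil : IsRow ([] : List α) ∅ where
  bound l e h _ := by simp at h
  attained a ha := by simp at ha

theorem append_of_card (h : IsRow L A)
    (h1 : ∀ e, (A.filter (· ≤ e)).card ≤ (B.filter (· ≤ e)).card)
    (h2 : (B.filter (· ≤ y)).card = (A.filter (· < y)).card + 1)
    (h3 : ∀ a ∈ B, a ≠ y → a ∈ A ∧ (B.filter (· ≤ a)).card = (A.filter (· ≤ a)).card) :
    IsRow (L ++ [y]) B where
  bound l e hs hp := by
    rw [List.sublist_append_iff] at hs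
    obtain ⟨l₁, l₂, he, hl₁, hl₂⟩ := hs
    rcases List.eq_nil_or_concat' l₂ with rfl | ⟨l₂, e', rfl⟩
    · rw [List.append_nil] at he
      exact (h.bound l e (he ▸ hl₁) hp).trans (h1 e)
    · have hlen := hl₂.length_le
      simp only [List.length_append, List.length_cons, List.length_nil] at hlen
      obtain rfl : l₂ = [] := List.length_eq_zero_iff.1 (by omega)
      rw [List.nil_append] at hl₂
      obtain ⟨rfl, he⟩ := List.append_inj' he rfl
      obtain rfl : e = e' := by simpa using he
      obtain rfl : e = y := by simpa using hl₂
      rw [h2]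
      rcases List.eq_nil_or_concat' l with rfl | ⟨l, d, rfl⟩
      · simp
      · have hd : d < e := by
          rw [List.pairwise_append] at hp
          exact hp.2.2 d (by simp) e (by simp)
        have := h.bound l d hl₁ (List.pairwise_append.1 hp).1
        have h' : (A.filter (· ≤ d)).card ≤ (A.filter (· < e)).card :=
          Finset.card_le_card fun a ha => by
            simp only [Finset.mem_filter] at ha ⊢
            exact ⟨ha.1, ha.2.trans_lt hd⟩
        simp only [List.length_append, List.length_cons, List.length_nil]
        omega
  attained a ha := by
    by_cases hay : a = y
    · subst hay
      rcases (A.filter (· < a)).eq_empty_or_nonempty with hE | hE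
      · exact ⟨[], by simp, by simp, by rw [h2, hE]; simp⟩
      · obtain ⟨hbA, hba⟩ := Finset.mem_filter.1 (Finset.max'_mem _ hE)
        have hmax := fun c (hc : c ∈ A.filter (· < a)) => Finset.le_max' _ c hc
        set b := (A.filter (· < a)).max' hE
        obtain ⟨l, hl, hp, hc⟩ := h.attained b hbA
        refine ⟨l ++ [b], hl.append_right [a], ?_, ?_⟩
        · rw [List.pairwise_append]
          refine ⟨hp, by simp, fun c hc d hd => ?_⟩
          obtain rfl : d = a := by simpa using hd
          rcases List.mem_append.1 hc with hc | hc
          · exact ((List.pairwise_append.1 hp).2.2 c hc b (by simp)).trans hba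
          · obtain rfl : c = b := by simpa using hc
            exact hba
        · rw [h2, List.length_append, List.length_singleton, hc]
          congr 2
          ext c
          simp only [Finset.mem_filter]
          exact ⟨fun hc => ⟨hc.1, hc.2.trans_lt hba⟩, fun hc => ⟨hc.1, hmax c (by simp [hc])⟩⟩
    · obtain ⟨haA, hca⟩ := h3 a ha hay
      obtain ⟨l, hl, hp, hc⟩ := h.attained a haA
      exact ⟨l, hl.trans (List.sublist_append_left _ _), hp, hc.trans hca.symm⟩

theorem append_of_forall_lt (h : IsRow L A) (hy : ∀ a ∈ A, a < y) :
    IsRow (L ++ [y]) (insert y A) := by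
  have hyA : y ∉ A := fun h' => (hy y h').false
  refine h.append_of_card (fun e => ?_) ?_ fun a ha hay => ?_
  · exact Finset.card_le_card (Finset.filter_subset_filter _ (Finset.subset_insert _ _))
  · rw [← Finset.card_insert_of_notMem (a := y) (by simp)]
    congr 1
    ext a
    simp only [Finset.mem_filter, Finset.mem_insert]
    constructor
    · rintro ⟨rfl | h1, h2⟩
      · exact Or.inl rfl
      · exact Or.inr ⟨h1, hy a h1⟩
    · rintro (rfl | h1)
      · exact ⟨Or.inl rfl, le_rfl⟩
      · exact ⟨Or.inr h1.1, h1.2.le⟩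
  · have haA := (Finset.mem_insert.1 ha).resolve_left hay
    refine ⟨haA, ?_⟩
    rw [Finset.filter_insert, if_neg (hy a haA).not_ge]

theorem append_of_bumpStep (h : IsRow L A) (hb : BumpStep A y z B) : IsRow (L ++ [y]) B := by
  have hyA := hb.notMem
  have hge : ∀ e, z ≤ e → (B.filter (· ≤ e)).card = (A.filter (· ≤ e)).card := by
    intro e he
    rw [hb.eq, Finset.filter_insert, if_pos (hb.lt.le.trans he), Finset.filter_erase,
      Finset.card_insert_of_notMem (by simp [hyA]),
      Finset.card_erase_add_one (by simp [hb.mem, he])]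
  refine h.append_of_card (fun e => ?_) ?_ fun a ha hay => ?_
  · rcases le_or_gt z e with he | he
    · exact (hge e he).ge
    · refine Finset.card_le_card fun a ha => ?_
      rw [Finset.mem_filter] at ha ⊢
      rw [hb.eq]
      simp [ha.1, ha.2, (ha.2.trans_lt he).ne]
  · rw [← Finset.card_insert_of_notMem (a := y) (by simp)]
    congr 1
    ext a
    rw [hb.eq]
    simp only [Finset.mem_filter, Finset.mem_insert, Finset.mem_erase]
    constructor
    · rintro ⟨rfl | h1, h2⟩
      · exact Or.inl rfl
      · exact Or.inr ⟨h1.2, lt_of_le_of_ne h2 (by rintro rfl; exact hyA h1.2)⟩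
    · rintro (rfl | h1)
      · exact ⟨Or.inl rfl, le_rfl⟩
      · exact ⟨Or.inr ⟨(h1.2.trans hb.lt).ne, h1.1⟩, h1.2.le⟩
  · have haA : a ≠ z ∧ a ∈ A := by
      have := ha
      rw [hb.eq, Finset.mem_insert, Finset.mem_erase] at this
      exact this.resolve_left hay
    refine ⟨haA.2, ?_⟩
    rcases le_or_gt z a with hza | hza
    · exact hge a hza
    · congr 1
      ext c
      rw [hb.eq]
      simp only [Finset.mem_filter, Finset.mem_insert, Finset.mem_erase]
      constructor
      · rintro ⟨rfl | h1, h2⟩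
        · exact absurd (hb.lt_of_lt a haA.2 hza) h2.not_gt
        · exact ⟨h1.2, h2⟩
      · rintro ⟨h1, h2⟩
        exact ⟨Or.inr ⟨(h2.trans_lt hza).ne, h1⟩, h2⟩

theorem append_of_bumps (h : IsRow L A) (hb : Bumps A ys zs B) : IsRow (L ++ ys) B := by
  induction hb generalizing L with
  | nil => simpa using h
  | cons h' _ ih => simpa using ih (h.append_of_bumpStep h')

theorem of_sortedLT (R : List α) (hR : R.Pairwise (· < ·)) : IsRow R R.toFinset := by
  induction R using List.reverseRecOn with
  | nil => exact nil
  | append_singleton R y ih =>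
    rw [List.pairwise_append] at hR
    have := (ih hR.1).append_of_forall_lt (y := y) fun a ha =>
      hR.2.2 a (by simpa using ha) y (by simp)
    convert this using 1
    ext; simp

theorem sort (A : Finset α) : IsRow A.sort A := by
  have h := of_sortedLT A.sort A.sortedLT_sort.pairwise
  have hA : (A.sort (· ≤ ·)).toFinset = A := by ext; simp
  rwa [hA] at h

/-- The longest increasing subsequences of `L` have length the size of its row. -/
theorem exists_sublist_iff (h : IsRow L A) (k : ℕ) :
    (∃ l : List α, l.Sublist L ∧ l.Pairwise (· < ·) ∧ l.length = k) ↔ k ≤ A.card := by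
  constructor
  · rintro ⟨l, hl, hp, rfl⟩
    rcases List.eq_nil_or_concat' l with rfl | ⟨l, e, rfl⟩
    · simp
    · have := (h.bound l e hl hp).trans (Finset.card_filter_le _ _)
      simpa using this
  · intro hk
    rcases A.eq_empty_or_nonempty with rfl | hA
    · exact ⟨[], by simp, by simp, (Nat.le_zero.1 hk).symm⟩
    · obtain ⟨l, hl, hp, hc⟩ := h.attained _ (A.max'_mem hA)
      rw [Finset.filter_true_of_mem fun a ha => A.le_max' a ha] at hc
      refine ⟨(l ++ [A.max' hA]).take k, (List.take_sublist _ _).trans hl,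
        hp.sublist (List.take_sublist _ _), ?_⟩
      simp [hc, hk]

end IsRow

/-- A word without long increasing subsequences never extends the row of its increasing start. -/
theorem exists_bumps (A : Finset α) (ys : List α) (hnd : (A.sort ++ ys).Nodup)
    (h : ¬ ∃ l : List α, l.Sublist (A.sort ++ ys) ∧ l.Pairwise (· < ·) ∧ l.length = A.card + 1) :
    ∃ zs B, Bumps A ys zs B := by
  induction ys using List.reverseRecOn with
  | nil => exact ⟨[], A, .nil A⟩
  | append_singleton ys y ih =>
    rw [← List.append_assoc] at hnd h
    obtain ⟨zs, B, hb⟩ := ih hnd.of_append_left fun ⟨l, h1, h2⟩ =>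
      h ⟨l, h1.trans (List.sublist_append_left _ _), h2⟩
    have hrow := (IsRow.sort A).append_of_bumps hb
    have hyB : y ∉ B := by
      intro hy
      have := (hb.mem_iff y).2 (Or.inr hy)
      rw [List.nodup_append] at hnd
      exact hnd.2.2 y (by simpa using this) y (by simp) rfl
    by_cases hlt : ∃ b ∈ B, y < b
    · obtain ⟨z, C, hs⟩ := BumpStep.exists_of_lt hyB hlt
      exact ⟨_, _, hb.append_singleton hs⟩
    · push Not at hlt
      have := hrow.append_of_forall_lt (y := y) fun b hb =>
        lt_of_le_of_ne (hlt b hb) (by rintro rfl; exact hyB hb)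
      refine absurd ((this.exists_sublist_iff _).2 ?_) h
      rw [Finset.card_insert_of_notMem hyB, hb.card_eq]

end Row

section Perm

variable {n : ℕ} {w π : Equiv.Perm (Fin n)} {zs rest : List (Fin n)} {B : Finset (Fin n)}

theorem pair_sublist_ofFn_iff (w : Equiv.Perm (Fin n)) (u v : Fin n) :
    [v, u].Sublist (List.ofFn w) ↔ w⁻¹ v < w⁻¹ u := by
  rw [List.sublist_iff_exists_fin_orderEmbedding_get_eq]
  constructor
  · rintro ⟨f, hf⟩
    have h0 := hf ⟨0, by simp⟩
    have h1 := hf ⟨1, by simp⟩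
    simp only [List.get_eq_getElem, List.getElem_cons_zero, List.getElem_cons_succ,
      List.getElem_ofFn] at h0 h1
    have h01 : f ⟨0, by simp⟩ < f ⟨1, by simp⟩ := f.lt_iff_lt.2 (by simp)
    simp only [h0, h1, Equiv.Perm.inv_def, Equiv.symm_apply_apply]
    exact h01
  · intro h
    have hlen : (List.ofFn w).length = n := List.length_ofFn
    refine ⟨OrderEmbedding.ofStrictMono
      (fun i => if (i : ℕ) = 0 then (w⁻¹ v).cast hlen.symm else (w⁻¹ u).cast hlen.symm) ?_, ?_⟩
    · rintro ⟨i, hi⟩ ⟨j, hj⟩ hij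
      simp only [List.length_cons, List.length_nil] at hi hj
      rw [Fin.mk_lt_mk] at hij
      obtain rfl : i = 0 := by omega
      obtain rfl : j = 1 := by omega
      simpa using h
    · rintro ⟨i, hi⟩
      simp only [List.length_cons, List.length_nil] at hi
      interval_cases i <;> simp

theorem maj_inv_congr
    (h : ∀ u v : Fin n, u ⋖ v → ([v, u].Sublist (List.ofFn w) ↔ [v, u].Sublist (List.ofFn π))) :
    maj w⁻¹ = maj π⁻¹ := by
  unfold maj
  refine Finset.sum_congr rfl fun i _ => ?_
  split_ifs with hi h1 h2 h2
  · rfl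
  all_goals first | rfl | skip
  all_goals
    have := h ⟨i, Nat.lt_of_succ_lt hi⟩ ⟨i + 1, hi⟩ (by rw [Fin.covBy_iff]; simp)
    rw [pair_sublist_ofFn_iff, pair_sublist_ofFn_iff] at this
    tauto

theorem hasIncSubseqPrefix_iff {L₁ L₂ : List (Fin n)} (h : List.ofFn w = L₁ ++ L₂) (k : ℕ) :
    HasIncSubseqPrefix w L₁.length k ↔
      ∃ l : List (Fin n), l.Sublist L₁ ∧ l.Pairwise (· < ·) ∧ l.length = k := by
  have hlen : L₁.length ≤ n := by
    have := congrArg List.length h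
    rw [List.length_ofFn, List.length_append] at this
    omega
  have hget : ∀ i (hi : i < L₁.length), L₁[i] = w ⟨i, hi.trans_le hlen⟩ := by
    intro i hi
    have : (List.ofFn w)[i]'(by simp; omega) = L₁[i] := by
      simp only [h]; exact List.getElem_append_left hi
    rw [← this, List.getElem_ofFn]
  constructor
  · rintro ⟨f, hf, hlt, hw⟩
    refine ⟨List.ofFn fun j => w (f j), ?_, (List.sortedLT_ofFn_iff.2 hw).pairwise, by simp⟩
    rw [List.sublist_iff_exists_fin_orderEmbedding_get_eq]
    refine ⟨OrderEmbedding.ofStrictMono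
      (fun i => ⟨f (i.cast (by simp)), hlt _⟩) fun i j hij => ?_, fun i => ?_⟩
    · exact hf (by simpa using hij)
    · simp only [List.get_eq_getElem, List.getElem_ofFn, hget]
      rfl
  · rintro ⟨l, hl, hp, rfl⟩
    obtain ⟨f, hf⟩ := List.sublist_iff_exists_fin_orderEmbedding_get_eq.1 hl
    refine ⟨fun j => (f j).castLE hlen, fun i j hij => f.lt_iff_lt.2 hij, fun j => (f j).2, ?_⟩
    intro i j hij
    have key : ∀ j, w ((f j).castLE hlen) = l.get j := by
      intro j
      rw [hf, List.get_eq_getElem, hget]; rfl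
    simp only [key]
    exact hp.sortedLT.strictMono_get hij

theorem prefixInc_iff {s : ℕ} {L₁ L₂ : List (Fin n)} (h : List.ofFn w = L₁ ++ L₂)
    (hL : L₁.length = n - s) : PrefixInc n s w ↔ L₁.Pairwise (· < ·) := by
  have hget : ∀ i (hi : i < L₁.length), L₁[i] = w ⟨i, by omega⟩ := by
    intro i hi
    have : (List.ofFn w)[i]'(by simp; omega) = L₁[i] := by
      simp only [h]; exact List.getElem_append_left hi
    rw [← this, List.getElem_ofFn]
  rw [List.pairwise_iff_getElem]
  constructor
  · intro hw i j hi hj hij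
    rw [hget, hget]
    exact hw _ _ hij (hL ▸ hj)
  · intro hw i j hij hj
    have := hw i j (by omega) (by omega) hij
    rwa [hget, hget] at this

theorem exists_ofFn_eq {L : List (Fin n)} (hL : L.length = n) (hmem : ∀ x, x ∈ L) :
    ∃ π : Equiv.Perm (Fin n), List.ofFn π = L := by
  have hs : Function.Surjective fun i : Fin n => L.get (i.cast hL.symm) := by
    intro x
    obtain ⟨i, hi⟩ := List.get_of_mem (hmem x)
    exact ⟨i.cast hL, by simpa using hi⟩
  refine ⟨Equiv.ofBijective _ (Finite.surjective_iff_bijective.1 hs), ?_⟩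
  apply List.ext_getElem <;> simp [hL]

/-- The word of `w` is an increasing row `A`, letters bumping out `zs` from `A` and leaving the row
`B`, and the remaining letters `rest`. -/
def BumpDecomp (w : Equiv.Perm (Fin n)) (zs : List (Fin n)) (B : Finset (Fin n))
    (rest : List (Fin n)) : Prop :=
  ∃ A ys, List.ofFn w = A.sort ++ (ys ++ rest) ∧ Bumps A ys zs B

namespace BumpDecomp

theorem length_eq (h : BumpDecomp w zs B rest) : zs.length + B.card + rest.length = n := by
  obtain ⟨A, ys, hw, hb⟩ := h
  have := congrArg List.length hw
  simp only [List.length_ofFn, List.length_append, Finset.length_sort] at this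
  have h1 := hb.length_eq
  have h2 := hb.card_eq
  omega

theorem mem (h : BumpDecomp w zs B rest) (x : Fin n) : x ∈ zs ∨ x ∈ B ∨ x ∈ rest := by
  obtain ⟨A, ys, hw, hb⟩ := h
  have hx : x ∈ List.ofFn w := by
    rw [List.mem_ofFn]; exact w.surjective x
  have := hb.mem_iff x
  rw [hw] at hx
  simp only [List.mem_append, Finset.mem_sort] at hx
  tauto

theorem nodup (h : BumpDecomp w zs B rest) : (zs ++ (B.sort ++ rest)).Nodup := by
  obtain ⟨π, hπ⟩ := exists_ofFn_eq (L := zs ++ (B.sort ++ rest))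
    (by have := h.length_eq; simp only [List.length_append, Finset.length_sort]; omega)
    (fun x => by simpa using h.mem x)
  rw [← hπ, List.nodup_ofFn]
  exact π.injective

theorem left_unique (h : BumpDecomp w zs B rest) (h' : BumpDecomp π zs B rest) : w = π := by
  obtain ⟨A, ys, hw, hb⟩ := h
  obtain ⟨A', ys', hw', hb'⟩ := h'
  obtain ⟨rfl, rfl⟩ := hb.left_unique hb'
  exact DFunLike.coe_injective (List.ofFn_injective (hw.trans hw'.symm))

theorem right_unique {zs' rest' : List (Fin n)} {B' : Finset (Fin n)}
    (h : BumpDecomp w zs B rest) (h' : BumpDecomp w zs' B' rest')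
    (hB : B.card = B'.card) (hz : zs.length = zs'.length) : zs = zs' ∧ B = B' ∧ rest = rest' := by
  obtain ⟨A, ys, hw, hb⟩ := h
  obtain ⟨A', ys', hw', hb'⟩ := h'
  obtain ⟨h1, h2⟩ := List.append_inj (hw.symm.trans hw')
    (by rw [Finset.length_sort, Finset.length_sort, ← hb.card_eq, ← hb'.card_eq, hB])
  obtain ⟨rfl, rfl⟩ := List.append_inj h2 (by rw [hb.length_eq, hb'.length_eq, hz])
  obtain rfl : A = A' := by
    ext x
    rw [← Finset.mem_sort (r := (· ≤ ·)), h1, Finset.mem_sort]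
  obtain ⟨rfl, rfl⟩ := hb.right_unique hb'
  exact ⟨rfl, rfl, rfl⟩

theorem prefixInc (h : BumpDecomp w zs B rest) {s : ℕ} (hs : B.card = n - s) :
    PrefixInc n s w := by
  obtain ⟨A, ys, hw, hb⟩ := h
  rw [prefixInc_iff hw (by rw [Finset.length_sort, ← hb.card_eq, hs])]
  exact A.sortedLT_sort.pairwise

theorem hasIncSubseqPrefix_iff (h : BumpDecomp w zs B rest) (k : ℕ) :
    HasIncSubseqPrefix w (B.card + zs.length) k ↔ k ≤ B.card := by
  obtain ⟨A, ys, hw, hb⟩ := h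
  rw [← List.append_assoc] at hw
  rw [← ((IsRow.sort A).append_of_bumps hb).exists_sublist_iff, ← _root_.hasIncSubseqPrefix_iff hw,
    List.length_append, Finset.length_sort, hb.card_eq, hb.length_eq]

theorem hasIncSubseqPrefix_succ_iff {x : Fin n} (h : BumpDecomp w zs B (x :: rest)) :
    HasIncSubseqPrefix w (B.card + zs.length + 1) (B.card + 1) ↔ ∀ b ∈ B, b < x := by
  have hxB : x ∉ B := by
    intro hx
    have := h.nodup
    rw [List.nodup_append, List.nodup_append] at this
    exact this.2.1.2.2 x (by simpa using hx) x (by simp) rfl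
  obtain ⟨A, ys, hw, hb⟩ := h
  have hw' : List.ofFn w = (A.sort ++ ys ++ [x]) ++ rest := by simpa using hw
  have hrow := (IsRow.sort A).append_of_bumps hb
  have hlen : B.card + zs.length + 1 = (A.sort ++ ys ++ [x]).length := by
    simp only [hb.card_eq, hb.length_eq, List.length_append, Finset.length_sort,
      List.length_singleton]
  rw [hlen, _root_.hasIncSubseqPrefix_iff hw']
  by_cases hlt : ∀ b ∈ B, b < x
  · rw [(hrow.append_of_forall_lt hlt).exists_sublist_iff, Finset.card_insert_of_notMem hxB]
    exact iff_of_true le_rfl hlt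
  · have : ∃ b ∈ B, x < b := by
      push Not at hlt
      obtain ⟨b, hb, hxb⟩ := hlt
      exact ⟨b, hb, lt_of_le_of_ne hxb (by rintro rfl; exact hxB hb)⟩
    obtain ⟨z, C, hs⟩ := BumpStep.exists_of_lt hxB this
    rw [(hrow.append_of_bumpStep hs).exists_sublist_iff, hs.card_eq]
    exact iff_of_false (by omega) hlt

theorem maj_inv_eq {x : Fin n} (h : BumpDecomp w zs (insert x B) rest)
    (h' : BumpDecomp π zs B (x :: rest)) (hx : ∀ b ∈ B, b < x) : maj w⁻¹ = maj π⁻¹ := by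
  refine maj_inv_congr fun u v huv => ?_
  obtain ⟨A, ys, hw, hb⟩ := h
  obtain ⟨A', ys', hw', hb'⟩ := h'
  rw [hw, hw', hb.pair_sublist_iff huv, hb'.pair_sublist_iff huv]
  have hsort : (insert x B).sort (· ≤ ·) = B.sort ++ [x] := by
    refine (Finset.sortedLT_sort _).eq_of_mem_iff ?_ (by simp [or_comm])
    rw [List.sortedLT_iff_pairwise, List.pairwise_append]
    exact ⟨B.sortedLT_sort.pairwise, by simp, by simpa using hx⟩
  rw [hsort, List.append_assoc, List.singleton_append]

theorem exists_erase (h : BumpDecomp w zs B rest) (hc : zs.length < B.card) :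
    ∃ x C π, B = insert x C ∧ (∀ b ∈ C, b < x) ∧ BumpDecomp π zs C (x :: rest) := by
  have hne : B.Nonempty := Finset.card_pos.1 (by omega)
  have hmem := h.mem
  have hlen := h.length_eq
  obtain ⟨A, ys, hw, hb⟩ := h
  have hx := B.max'_mem hne
  have hlt : ∀ b ∈ B.erase (B.max' hne), b < B.max' hne := fun b hb =>
    B.lt_max'_of_mem_erase_max' hne hb
  set x := B.max' hne
  have hfilter : B.erase x ⊆ B.filter (· < x) := fun b hb => by
    simp [Finset.mem_of_mem_erase hb, hlt b hb]
  have hcard := Finset.card_le_card hfilter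
  rw [Finset.card_erase_of_mem hx] at hcard
  obtain ⟨x', hx', ys', hb', -⟩ := hb.exists_erase hx (by omega)
  obtain ⟨π, hπ⟩ := exists_ofFn_eq (L := (A.erase x').sort ++ (ys' ++ x :: rest))
    (by
      have h1 := hb'.length_eq
      have h2 := hb'.card_eq
      rw [Finset.card_erase_of_mem hx] at h2
      simp only [List.length_append, Finset.length_sort, List.length_cons]
      omega)
    (fun y => by
      have h1 := hmem y
      have h2 := hb'.mem_iff y
      rw [Finset.mem_erase (s := B)] at h2
      simp only [List.mem_append, Finset.mem_sort, List.mem_cons]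
      tauto)
  exact ⟨x, B.erase x, π, (Finset.insert_erase hx).symm, hlt, _, _, hπ, hb'⟩

theorem exists_insert {x : Fin n} (h : BumpDecomp π zs B (x :: rest)) :
    ∃ w, BumpDecomp w zs (insert x B) rest := by
  have hmem := h.mem
  have hlen := h.length_eq
  have hnd := h.nodup
  rw [List.nodup_append, List.nodup_append] at hnd
  obtain ⟨hzs, ⟨-, -, hB⟩, hz⟩ := hnd
  have hxB : x ∉ B := fun hx => hB x (by simpa using hx) x (by simp) rfl
  obtain ⟨A, ys, hw, hb⟩ := h
  obtain ⟨x', ys', hx', hb'⟩ := hb.exists_insert hzs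
    (fun z h1 h2 => hz z h1 z (by simp [h2]) rfl) hxB (fun h1 => hz x h1 x (by simp) rfl)
  obtain ⟨w, hw⟩ := exists_ofFn_eq (L := (insert x' A).sort ++ (ys' ++ rest))
    (by
      have h1 := hb'.length_eq
      have h2 := hb'.card_eq
      rw [Finset.card_insert_of_notMem hxB] at h2
      simp only [List.length_append, Finset.length_sort]
      rw [List.length_cons] at hlen
      omega)
    (fun y => by
      have h1 := hmem y
      have h2 := hb'.mem_iff y
      rw [Finset.mem_insert (s := B)] at h2
      rw [List.mem_cons] at h1
      simp only [List.mem_append, Finset.mem_sort]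
      tauto)
  exact ⟨w, _, _, hw, hb'⟩

end BumpDecomp

theorem exists_bumpDecomp {s j : ℕ} (hj : n - s + j ≤ n) (hw : PrefixInc n s w)
    (hinc : ¬ HasIncSubseqPrefix w (n - s + j) (n - s + 1)) :
    ∃ zs B rest, BumpDecomp w zs B rest ∧ B.card = n - s ∧ zs.length = j := by
  set L := List.ofFn w with hL
  have hlen : L.length = n := List.length_ofFn
  have h1 : L = L.take (n - s) ++ L.drop (n - s) := (List.take_append_drop _ _).symm
  have hsorted := (prefixInc_iff h1 (by simp [hlen])).1 hw
  obtain ⟨A, hA⟩ : ∃ A : Finset (Fin n), A.sort (· ≤ ·) = L.take (n - s) := by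
    refine ⟨(L.take (n - s)).toFinset, ?_⟩
    exact (Finset.sortedLT_sort _).eq_of_mem_iff hsorted.sortedLT (by simp)
  have hAc : A.card = n - s := by rw [← Finset.length_sort (r := (· ≤ ·)), hA]; simp [hlen]
  have h2 : L = (A.sort ++ (L.drop (n - s)).take j) ++ (L.drop (n - s)).drop j := by
    rw [List.append_assoc, List.take_append_drop, hA, List.take_append_drop]
  have hl2 : (A.sort ++ (L.drop (n - s)).take j).length = n - s + j := by
    simp [hlen, hAc]; omega
  rw [← hl2, hasIncSubseqPrefix_iff h2] at hinc
  have hnd : L.Nodup := by rw [hL, List.nodup_ofFn]; exact w.injective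
  obtain ⟨zs, B, hb⟩ := exists_bumps A _ (by rw [h2] at hnd; exact hnd.of_append_left) (by rwa [hAc])
  refine ⟨zs, B, (L.drop (n - s)).drop j, ⟨A, _, by rw [← List.append_assoc]; exact h2, hb⟩,
    hb.card_eq.trans hAc, ?_⟩
  rw [← hb.length_eq]
  simp [hlen]; omega

theorem prefixInc_and_not_hasIncSubseqPrefix_iff {s j : ℕ} (hj : n - s + j ≤ n) :
    PrefixInc n s w ∧ ¬ HasIncSubseqPrefix w (n - s + j) (n - s + 1) ↔
      ∃ zs B rest, BumpDecomp w zs B rest ∧ B.card = n - s ∧ zs.length = j := by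
  constructor
  · rintro ⟨hw, hinc⟩
    exact exists_bumpDecomp hj hw hinc
  · rintro ⟨zs, B, rest, h, hB, rfl⟩
    refine ⟨h.prefixInc hB, ?_⟩
    rw [← hB, h.hasIncSubseqPrefix_iff]
    omega

theorem memCa_iff {s j : ℕ} (hj : n - s + j + 1 ≤ n) :
    MemCa n s (n - s + j + 1) w ↔ ∃ zs B x rest, BumpDecomp w zs B (x :: rest) ∧
      B.card = n - s ∧ zs.length = j ∧ ∀ b ∈ B, b < x := by
  rw [MemCa, Nat.add_sub_cancel]
  constructor
  · rintro ⟨hw, hinc, hinc'⟩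
    obtain ⟨zs, B, rest, h, hB, rfl⟩ := exists_bumpDecomp (by omega) hw hinc'
    cases rest with
    | nil =>
      have := h.length_eq
      rw [List.length_nil] at this
      omega
    | cons x rest =>
      refine ⟨zs, B, x, rest, h, hB, rfl, ?_⟩
      rwa [← h.hasIncSubseqPrefix_succ_iff, hB]
  · rintro ⟨zs, B, x, rest, h, hB, rfl, hx⟩
    refine ⟨h.prefixInc hB, ?_, ?_⟩
    · rwa [← hB, h.hasIncSubseqPrefix_succ_iff]
    · rw [← hB, h.hasIncSubseqPrefix_iff]
      omega

open Classical in
/-- The permutations whose first `n - s` values are increasing and whose prefix of length `a` has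
no longer increasing subsequence. -/
noncomputable def shortPrefixFinset (n s a : ℕ) : Finset (Equiv.Perm (Fin n)) :=
  Finset.univ.filter fun w => PrefixInc n s w ∧ ¬ HasIncSubseqPrefix w a (n - s + 1)

theorem mem_CaFinset {s a : ℕ} : w ∈ CaFinset n s a ↔ MemCa n s a w := by
  simp [CaFinset]

theorem mem_shortPrefixFinset {s a : ℕ} : w ∈ shortPrefixFinset n s a ↔
    PrefixInc n s w ∧ ¬ HasIncSubseqPrefix w a (n - s + 1) := by
  simp [shortPrefixFinset]

theorem HasIncSubseqPrefix.mono {a b k : ℕ} (hab : a ≤ b) (h : HasIncSubseqPrefix w a k) :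
    HasIncSubseqPrefix w b k := by
  obtain ⟨f, h1, h2, h3⟩ := h
  exact ⟨f, h1, fun j => (h2 j).trans_le hab, h3⟩

theorem HasIncSubseqPrefix.le {a k : ℕ} (h : HasIncSubseqPrefix w a k) : k ≤ a := by
  obtain ⟨f, h1, h2, -⟩ := h
  have := Fintype.card_le_of_injective (fun j : Fin k => (⟨f j, h2 j⟩ : Fin a)) fun i j hij =>
    h1.injective (Fin.ext (by simpa using hij))
  simpa using this

theorem sum_CFinset_eq {M : Type*} [AddCommMonoid M] (f : Equiv.Perm (Fin n) → M) (s a : ℕ)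
    (ha : n - s ≤ a) :
    ∑ w ∈ CFinset n s, f w = ∑ w ∈ shortPrefixFinset n s a, f w +
      ∑ b ∈ Finset.Icc (n - s + 1) a, ∑ w ∈ CaFinset n s b, f w := by
  classical
  induction a, ha using Nat.le_induction with
  | base =>
    rw [Finset.Icc_eq_empty (by omega), Finset.sum_empty, add_zero]
    refine Finset.sum_congr ?_ fun _ _ => rfl
    ext w
    simp only [CFinset, Finset.mem_filter, Finset.mem_univ, true_and, mem_shortPrefixFinset]
    exact ⟨fun h => ⟨h, fun h' => by have := h'.le; omega⟩, fun h => h.1⟩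
  | succ a ha ih =>
    rw [Finset.sum_Icc_succ_top (by omega), ih]
    have hd : shortPrefixFinset n s a =
        (shortPrefixFinset n s (a + 1)).disjUnion (CaFinset n s (a + 1)) (by
          rw [Finset.disjoint_left]
          intro w h1 h2
          exact (mem_shortPrefixFinset.1 h1).2 (mem_CaFinset.1 h2).2.1) := by
      ext w
      rw [Finset.mem_disjUnion, mem_shortPrefixFinset, mem_shortPrefixFinset, mem_CaFinset, MemCa,
        Nat.add_sub_cancel]
      have := HasIncSubseqPrefix.mono (w := w) (k := n - s + 1) (Nat.le_succ a)
      tauto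
    rw [hd, Finset.sum_disjUnion, add_assoc, add_comm (∑ w ∈ CaFinset n s (a + 1), f w)]

/-- The correspondence given by moving the largest entry of the final row to the end of the
bumping word, keeping the bumped letters. -/
def BumpRel (k j : ℕ) (w π : Equiv.Perm (Fin n)) : Prop :=
  ∃ zs B x rest, BumpDecomp w zs (insert x B) rest ∧ BumpDecomp π zs B (x :: rest) ∧
    (∀ b ∈ B, b < x) ∧ B.card = k ∧ zs.length = j

namespace BumpRel

variable {k j : ℕ} {w' π' : Equiv.Perm (Fin n)}

theorem maj_inv_eq (h : BumpRel k j w π) : maj w⁻¹ = maj π⁻¹ := by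
  obtain ⟨zs, B, x, rest, h1, h2, h3, -, -⟩ := h
  exact h1.maj_inv_eq h2 h3

theorem left_unique (h : BumpRel k j w π) (h' : BumpRel k j w' π) : w = w' := by
  obtain ⟨zs, B, x, rest, h1, h2, h3, h4, h5⟩ := h
  obtain ⟨zs', B', x', rest', h1', h2', h3', h4', h5'⟩ := h'
  obtain ⟨rfl, rfl, he⟩ := h2.right_unique h2' (h4.trans h4'.symm) (h5.trans h5'.symm)
  obtain ⟨rfl, rfl⟩ := List.cons_eq_cons.1 he
  exact h1.left_unique h1'

theorem right_unique (h : BumpRel k j w π) (h' : BumpRel k j w π') : π = π' := by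
  obtain ⟨zs, B, x, rest, h1, h2, h3, h4, h5⟩ := h
  obtain ⟨zs', B', x', rest', h1', h2', h3', h4', h5'⟩ := h'
  have hxB : x ∉ B := fun h => (h3 x h).false
  have hxB' : x' ∉ B' := fun h => (h3' x' h).false
  obtain ⟨rfl, he, rfl⟩ := h1.right_unique h1'
    (by rw [Finset.card_insert_of_notMem hxB, Finset.card_insert_of_notMem hxB', h4, h4'])
    (h5.trans h5'.symm)
  have hx : x ∈ insert x' B' := he ▸ Finset.mem_insert_self _ _
  have hx' : x' ∈ insert x B := he ▸ Finset.mem_insert_self _ _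
  obtain rfl : x = x' := by
    rcases Finset.mem_insert.1 hx with h | h
    · exact h
    · rcases Finset.mem_insert.1 hx' with h' | h'
      · exact h'.symm
      · exact absurd (h3 _ h') (h3' _ h).not_gt
  obtain rfl : B = B' := by
    rw [← Finset.erase_insert hxB, he, Finset.erase_insert hxB']
  exact h2.left_unique h2'

end BumpRel

theorem exists_bumpRel_left {s a : ℕ} (hs : 1 ≤ s) (h : 2 * s ≤ n) (ha1 : n - s + 1 ≤ a)
    (ha2 : a ≤ n) (hw : w ∈ shortPrefixFinset n (s - 1) a) :
    ∃ π ∈ CaFinset n s a, BumpRel (n - s) (a - (n - s + 1)) w π := by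
  obtain ⟨j, rfl⟩ := Nat.exists_eq_add_of_le ha1
  have e : n - (s - 1) = n - s + 1 := by omega
  rw [mem_shortPrefixFinset, ← e, prefixInc_and_not_hasIncSubseqPrefix_iff (by omega), e] at hw
  obtain ⟨zs, B, rest, hd, hB, rfl⟩ := hw
  obtain ⟨x, C, π, rfl, hC, hπ⟩ := hd.exists_erase (by omega)
  rw [Finset.card_insert_of_notMem fun h => (hC x h).false] at hB
  refine ⟨π, ?_, zs, C, x, rest, hd, hπ, hC, by omega, by omega⟩
  rw [mem_CaFinset, add_right_comm, memCa_iff (by omega)]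
  exact ⟨zs, C, x, rest, hπ, by omega, rfl, hC⟩

theorem exists_bumpRel_right {s a : ℕ} (hs : 1 ≤ s) (h : 2 * s ≤ n) (ha1 : n - s + 1 ≤ a)
    (ha2 : a ≤ n) (hπ : π ∈ CaFinset n s a) :
    ∃ w ∈ shortPrefixFinset n (s - 1) a, BumpRel (n - s) (a - (n - s + 1)) w π := by
  obtain ⟨j, rfl⟩ := Nat.exists_eq_add_of_le ha1
  have e : n - (s - 1) = n - s + 1 := by omega
  rw [mem_CaFinset, add_right_comm, memCa_iff (by omega)] at hπ
  obtain ⟨zs, B, x, rest, hd, hB, rfl, hx⟩ := hπ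
  obtain ⟨w, hw⟩ := hd.exists_insert
  refine ⟨w, ?_, zs, B, x, rest, hw, hd, hx, hB, by omega⟩
  rw [mem_shortPrefixFinset, ← e, prefixInc_and_not_hasIncSubseqPrefix_iff (by omega), e]
  refine ⟨zs, _, rest, hw, ?_, rfl⟩
  rw [Finset.card_insert_of_notMem fun h => (hx x h).false, hB]

end Perm

/-- For `n >= 2s`, `s >= 1` and `n-s+1 ≤ a ≤ n`, the generating function of `maj(π⁻¹)`
over `C_{n,s,a}` equals that over `C_{n,s-1}` minus the sum of those over `C_{n,s-1,b}`
for `n-s+2 ≤ b ≤ a`. -/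
theorem ca_maj_q (n s a : ℕ) (hs : 1 ≤ s) (h : 2 * s ≤ n)
    (ha1 : n - s + 1 ≤ a) (ha2 : a ≤ n) :
    ∑ π ∈ CaFinset n s a, (X : Polynomial ℤ) ^ maj π⁻¹ =
      ∑ w ∈ CFinset n (s - 1), (X : Polynomial ℤ) ^ maj w⁻¹ -
        ∑ b ∈ Finset.Icc (n - s + 2) a,
          ∑ w ∈ CaFinset n (s - 1) b, (X : Polynomial ℤ) ^ maj w⁻¹ := by
  rw [sum_CFinset_eq _ (s - 1) a (by omega), show n - (s - 1) + 1 = n - s + 2 by omega,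
    add_sub_cancel_right]
  choose! i hi hrel using fun π (hπ : π ∈ CaFinset n s a) =>
    exists_bumpRel_right hs h ha1 ha2 hπ
  refine Finset.sum_bij (fun π _ => i π) hi ?_ ?_ ?_
  · intro π hπ π' hπ' he
    exact (hrel π hπ).right_unique (he ▸ hrel π' hπ')
  · intro w hw
    obtain ⟨π, hπ, hr⟩ := exists_bumpRel_left hs h ha1 ha2 hw
    exact ⟨π, hπ, (hrel π hπ).left_unique hr⟩
  · intro π hπ
    rw [(hrel π hπ).maj_inv_eq]
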